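/- Let 0 < r < 1/2, h > 0, and let 0 = t₀ < t₁ < ⋯ < t_N = 1 be a partition of I = (0,1) into subintervals γᵢ = (tᵢ₋₁, tᵢ) each of length at most h. Let v : [0,1] → ℝ be absolutely continuous with square-integrable derivative g, choose points xᵢ ∈ γᵢ, and set w = v − v_h where v_h = ∑_{i=1}^N v(xᵢ) 1_{γᵢ}. Then there is an absolute constant C > 0 such that ∬_{I × I} |w(y) − w(x)|² / |y − x|^{1+2r} dx dy ≤ (C/(r(1 − 2r))) · h^{2−2r} · ∫₀¹ g(t)² dt. -/

import Mathlib

open MeasureTheory Set Finset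

theorem lintegral_Ioi_abs_rpow {r c : ℝ} (hr : 0 < r) (hc : 0 < c) :
    ∫⁻ z in Ioi c, ENNReal.ofReal (|z| ^ (-(1 + 2 * r))) =
      ENNReal.ofReal (c ^ (-(2 * r)) / (2 * r)) := by
  have h : ∫⁻ z in Ioi c, ENNReal.ofReal (|z| ^ (-(1 + 2 * r))) =
      ∫⁻ z in Ioi c, ENNReal.ofReal (z ^ (-(1 + 2 * r))) :=
    setLIntegral_congr_fun measurableSet_Ioi fun z hz => by
      simp only [abs_of_pos (hc.trans hz)]
  rw [h, ← ofReal_integral_eq_lintegral_ofReal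
    (integrableOn_Ioi_rpow_of_lt (by linarith) hc), integral_Ioi_rpow_of_lt (by linarith) hc]
  · rw [show -(1 + 2 * r) + 1 = -(2 * r) by ring, neg_div_neg_eq]
  · filter_upwards [ae_restrict_mem measurableSet_Ioi] with z hz
    exact Real.rpow_nonneg (hc.trans hz).le _

theorem lintegral_Icc_abs_rpow {r L : ℝ} (hr : r < 1 / 2) (hL : 0 ≤ L) :
    ∫⁻ z in Icc 0 L, ENNReal.ofReal (|z| ^ (-(2 * r))) =
      ENNReal.ofReal (L ^ (1 - 2 * r) / (1 - 2 * r)) := by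
  have h : ∫⁻ z in Icc 0 L, ENNReal.ofReal (|z| ^ (-(2 * r))) =
      ∫⁻ z in Icc 0 L, ENNReal.ofReal (z ^ (-(2 * r))) :=
    setLIntegral_congr_fun measurableSet_Icc fun z hz => by
      simp only [abs_of_nonneg hz.1]
  have hi := intervalIntegral.intervalIntegrable_rpow' (a := 0) (b := L)
    (show -1 < -(2 * r) by linarith)
  rw [intervalIntegrable_iff_integrableOn_Icc_of_le hL] at hi
  rw [h, ← ofReal_integral_eq_lintegral_ofReal hi, integral_Icc_eq_integral_Ioc,
    ← intervalIntegral.integral_of_le hL, integral_rpow (Or.inl (by linarith)),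
    Real.zero_rpow (by linarith)]
  · rw [show -(2 * r) + 1 = 1 - 2 * r by ring, sub_zero]
  · filter_upwards [ae_restrict_mem measurableSet_Icc] with z hz
    exact Real.rpow_nonneg hz.1 _

theorem setLIntegral_comp_sub_le (f : ℝ → ENNReal) (hf : Measurable f) (x : ℝ) {s t : Set ℝ}
    (ht : MeasurableSet t) (hst : ∀ y ∈ s, y - x ∈ t) :
    ∫⁻ y in s, f (y - x) ≤ ∫⁻ z in t, f z := by
  rw [← (measurePreserving_sub_right volume x).setLIntegral_comp_preimage ht hf]
  exact lintegral_mono_set hst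

theorem setLIntegral_comp_sub_left_le (f : ℝ → ENNReal) (hf : Measurable f) (x : ℝ) {s t : Set ℝ}
    (ht : MeasurableSet t) (hst : ∀ y ∈ s, x - y ∈ t) :
    ∫⁻ y in s, f (x - y) ≤ ∫⁻ z in t, f z := by
  rw [← (Measure.measurePreserving_sub_left volume x).setLIntegral_comp_preimage ht hf]
  exact lintegral_mono_set hst

theorem measurable_ofReal_abs_rpow (s : ℝ) :
    Measurable fun z : ℝ => ENNReal.ofReal (|z| ^ s) := by
  fun_prop

/-- The kernel `|y - x| ^ (-2r)` integrated over the square of an interval. -/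
theorem lintegral_Ioc_Ioc_abs_sub_rpow_le {r a b : ℝ} (hr : r < 1 / 2) (hab : a < b) :
    ∫⁻ x in Ioc a b, ∫⁻ y in Ioc a b, ENNReal.ofReal (|y - x| ^ (-(2 * r))) ≤
      ENNReal.ofReal (2 * (b - a) ^ (2 - 2 * r) / (1 - 2 * r)) := by
  have hL : 0 < b - a := sub_pos.2 hab
  have h1 : 0 < 1 - 2 * r := by linarith
  set Q := (b - a) ^ (1 - 2 * r) / (1 - 2 * r) with hQ
  have hQ0 : 0 ≤ Q := by positivity
  have key : ∀ x ∈ Ioc a b, ∫⁻ y in Ioc a b, ENNReal.ofReal (|y - x| ^ (-(2 * r))) ≤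
      ENNReal.ofReal (2 * Q) := by
    intro x hx
    calc ∫⁻ y in Ioc a b, ENNReal.ofReal (|y - x| ^ (-(2 * r)))
        ≤ ∫⁻ y in Icc x b ∪ Icc a x, ENNReal.ofReal (|y - x| ^ (-(2 * r))) := by
          refine lintegral_mono_set fun y hy => ?_
          rcases le_total x y with h | h
          exacts [Or.inl ⟨h, hy.2⟩, Or.inr ⟨hy.1.le, h⟩]
      _ ≤ _ := lintegral_union_le _ _ _
      _ ≤ ENNReal.ofReal Q + ENNReal.ofReal Q := by
          rw [hQ, ← lintegral_Icc_abs_rpow hr hL.le]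
          refine add_le_add ?_ ?_
          · exact setLIntegral_comp_sub_le _ (measurable_ofReal_abs_rpow _) x measurableSet_Icc
              fun y hy => ⟨by linarith [hy.1], by linarith [hy.2, hx.1]⟩
          · simp_rw [abs_sub_comm _ x]
            exact setLIntegral_comp_sub_left_le _ (measurable_ofReal_abs_rpow _) x
              measurableSet_Icc fun y hy => ⟨by linarith [hy.2], by linarith [hy.1, hx.2]⟩
      _ = ENNReal.ofReal (2 * Q) := by rw [← ENNReal.ofReal_add hQ0 hQ0, two_mul]
  calc _ ≤ ∫⁻ x in Ioc a b, ENNReal.ofReal (2 * Q) := setLIntegral_mono' measurableSet_Ioc key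
    _ = ENNReal.ofReal (2 * Q) * ENNReal.ofReal (b - a) := by simp
    _ = _ := by
      rw [← ENNReal.ofReal_mul (by positivity), hQ,
        show 2 - 2 * r = (1 - 2 * r) + 1 by ring, Real.rpow_add_one hL.ne']
      congr 1
      ring

/-- The kernel `|y - x| ^ (-(1 + 2r))` integrated over an interval times its complement. -/
theorem lintegral_Ioc_compl_abs_sub_rpow_le {r a b : ℝ} (hr0 : 0 < r) (hr : r < 1 / 2)
    (hab : a < b) :
    ∫⁻ x in Ioc a b, ∫⁻ y in (Ioc a b)ᶜ, ENNReal.ofReal (|y - x| ^ (-(1 + 2 * r))) ≤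
      ENNReal.ofReal ((b - a) ^ (1 - 2 * r) / (r * (1 - 2 * r))) := by
  have hL : 0 < b - a := sub_pos.2 hab
  have h1 : 0 < 1 - 2 * r := by linarith
  set Q := (b - a) ^ (1 - 2 * r) / (1 - 2 * r) with hQ
  have hQ0 : 0 ≤ Q := by positivity
  have key : ∀ x ∈ Ioo a b, ∫⁻ y in (Ioc a b)ᶜ, ENNReal.ofReal (|y - x| ^ (-(1 + 2 * r))) ≤
      ENNReal.ofReal (1 / (2 * r)) * (ENNReal.ofReal (|b - x| ^ (-(2 * r))) +
        ENNReal.ofReal (|x - a| ^ (-(2 * r)))) := by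
    intro x hx
    have hb : 0 < b - x := sub_pos.2 hx.2
    have ha : 0 < x - a := sub_pos.2 hx.1
    have hIci : Ici (x - a) =ᵐ[volume] Ioi (x - a) := Ioi_ae_eq_Ici.symm
    calc ∫⁻ y in (Ioc a b)ᶜ, ENNReal.ofReal (|y - x| ^ (-(1 + 2 * r)))
        ≤ ∫⁻ y in Ioi b ∪ Iic a, ENNReal.ofReal (|y - x| ^ (-(1 + 2 * r))) := by
          refine lintegral_mono_set fun y hy => ?_
          by_cases h : y ≤ a
          · exact Or.inr h
          · exact Or.inl (not_le.1 fun h' => hy ⟨not_le.1 h, h'⟩)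
      _ ≤ _ := lintegral_union_le _ _ _
      _ ≤ ENNReal.ofReal ((b - x) ^ (-(2 * r)) / (2 * r)) +
            ENNReal.ofReal ((x - a) ^ (-(2 * r)) / (2 * r)) := by
          rw [← lintegral_Ioi_abs_rpow hr0 hb, ← lintegral_Ioi_abs_rpow hr0 ha,
            ← Measure.restrict_congr_set hIci]
          refine add_le_add ?_ ?_
          · exact setLIntegral_comp_sub_le _ (measurable_ofReal_abs_rpow _) x measurableSet_Ioi
              fun y hy => sub_lt_sub_right hy x
          · simp_rw [abs_sub_comm _ x]
            exact setLIntegral_comp_sub_left_le _ (measurable_ofReal_abs_rpow _) x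
              measurableSet_Ici fun y hy => sub_le_sub_left hy x
      _ = _ := by
          rw [mul_add, ← ENNReal.ofReal_mul (by positivity), ← ENNReal.ofReal_mul (by positivity),
            abs_of_pos hb, abs_of_pos ha]
          congr 2 <;> ring
  have hm1 : Measurable fun x => ENNReal.ofReal (|b - x| ^ (-(2 * r))) := by fun_prop
  have hm2 : Measurable fun x => ENNReal.ofReal (|x - a| ^ (-(2 * r))) := by fun_prop
  rw [← Measure.restrict_congr_set (Ioo_ae_eq_Ioc (μ := volume) (a := a) (b := b))]
  calc _ ≤ ∫⁻ x in Ioo a b, ENNReal.ofReal (1 / (2 * r)) *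
        (ENNReal.ofReal (|b - x| ^ (-(2 * r))) + ENNReal.ofReal (|x - a| ^ (-(2 * r)))) :=
        setLIntegral_mono' measurableSet_Ioo key
    _ ≤ ENNReal.ofReal (1 / (2 * r)) * (ENNReal.ofReal Q + ENNReal.ofReal Q) := by
        rw [lintegral_const_mul _ (by fun_prop), lintegral_add_left hm1, hQ,
          ← lintegral_Icc_abs_rpow hr hL.le]
        refine mul_le_mul_right (add_le_add ?_ ?_) _
        · exact setLIntegral_comp_sub_left_le _ (measurable_ofReal_abs_rpow _) b
            measurableSet_Icc fun y hy => ⟨by linarith [hy.2], by linarith [hy.1]⟩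
        · exact setLIntegral_comp_sub_le _ (measurable_ofReal_abs_rpow _) a measurableSet_Icc
            fun y hy => ⟨by linarith [hy.1], by linarith [hy.2]⟩
    _ = _ := by
        rw [← ENNReal.ofReal_add hQ0 hQ0, ← ENNReal.ofReal_mul (by positivity), hQ]
        congr 1
        field_simp
        norm_num

/-- Cauchy–Schwarz against the constant function on an interval. -/
theorem sq_intervalIntegral_le {g : ℝ → ℝ} {p q : ℝ} (hpq : p ≤ q)
    (hg : IntegrableOn g (Icc p q)) (hg2 : IntegrableOn (fun s => g s ^ 2) (Icc p q)) :
    (∫ s in p..q, g s) ^ 2 ≤ (q - p) * ∫ s in p..q, g s ^ 2 := by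
  rcases hpq.eq_or_lt with rfl | hlt
  · simp
  have hi := (intervalIntegrable_iff_integrableOn_Icc_of_le hpq).2 hg
  have hi2 := (intervalIntegrable_iff_integrableOn_Icc_of_le hpq).2 hg2
  have hL : 0 < q - p := sub_pos.2 hlt
  set A := ∫ s in p..q, g s with hA
  have h0 : 0 ≤ ∫ s in p..q, ((q - p) * g s - A) ^ 2 :=
    intervalIntegral.integral_nonneg hpq fun s _ => sq_nonneg _
  have h1 : ∫ s in p..q, ((q - p) * g s - A) ^ 2 =
      (q - p) ^ 2 * (∫ s in p..q, g s ^ 2) - 2 * (q - p) * A * A + (q - p) * A ^ 2 := by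
    have : ∀ s, ((q - p) * g s - A) ^ 2 =
        (q - p) ^ 2 * g s ^ 2 - 2 * (q - p) * A * g s + A ^ 2 := fun s => by ring
    simp_rw [this]
    rw [intervalIntegral.integral_add ((hi2.const_mul _).sub (hi.const_mul _)) (by simp),
      intervalIntegral.integral_sub (hi2.const_mul _) (hi.const_mul _),
      intervalIntegral.integral_const_mul, intervalIntegral.integral_const_mul,
      intervalIntegral.integral_const, smul_eq_mul]
  rw [h1] at h0
  have h2 : 0 ≤ (q - p) * ((q - p) * (∫ s in p..q, g s ^ 2) - A ^ 2) := by linarith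
  linarith [nonneg_of_mul_nonneg_right h2 hL]

theorem lintegral_indicator_prod {S T : Set ℝ} (hS : MeasurableSet S) (hT : MeasurableSet T)
    {f : ℝ × ℝ → ENNReal} (hf : Measurable f) :
    ∫⁻ p, (S ×ˢ T).indicator f p ∂(volume.prod volume) = ∫⁻ x in S, ∫⁻ y in T, f (x, y) := by
  rw [lintegral_indicator (hS.prod hT), ← Measure.prod_restrict, lintegral_prod _ hf.aemeasurable]

/-- The contribution of the interval `(a, b]` to a pointwise bound of the Gagliardo integrand;
`G` stands for the integral of the squared derivative over that interval. -/
noncomputable def intervalMajorant (r a b G : ℝ) (p : ℝ × ℝ) : ENNReal :=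
  ENNReal.ofReal G * (Ioc a b ×ˢ Ioc a b).indicator
      (fun p => ENNReal.ofReal (|p.2 - p.1| ^ (-(2 * r)))) p +
    (ENNReal.ofReal (2 * ((b - a) * G)) * (Ioc a b ×ˢ (Ioc a b)ᶜ).indicator
      (fun p => ENNReal.ofReal (|p.2 - p.1| ^ (-(1 + 2 * r)))) p +
    ENNReal.ofReal (2 * ((b - a) * G)) * ((Ioc a b)ᶜ ×ˢ Ioc a b).indicator
      (fun p => ENNReal.ofReal (|p.2 - p.1| ^ (-(1 + 2 * r)))) p)

theorem measurable_ofReal_abs_sub_rpow (s : ℝ) :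
    Measurable fun p : ℝ × ℝ => ENNReal.ofReal (|p.2 - p.1| ^ s) := by
  fun_prop

theorem measurable_intervalMajorant (r a b G : ℝ) : Measurable (intervalMajorant r a b G) := by
  have hS : MeasurableSet (Ioc a b) := measurableSet_Ioc
  exact (((measurable_ofReal_abs_sub_rpow _).indicator (hS.prod hS)).const_mul _).add
    ((((measurable_ofReal_abs_sub_rpow _).indicator (hS.prod hS.compl)).const_mul _).add
      (((measurable_ofReal_abs_sub_rpow _).indicator (hS.compl.prod hS)).const_mul _))

theorem lintegral_intervalMajorant_le {r a b G : ℝ} (hr0 : 0 < r) (hr : r < 1 / 2)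
    (hab : a < b) (hG : 0 ≤ G) :
    ∫⁻ p, intervalMajorant r a b G p ∂(volume.prod volume) ≤
      ENNReal.ofReal (5 / (r * (1 - 2 * r)) * (b - a) ^ (2 - 2 * r) * G) := by
  have hS : MeasurableSet (Ioc a b) := measurableSet_Ioc
  have hL : 0 < b - a := sub_pos.2 hab
  have h1 : 0 < 1 - 2 * r := by linarith
  have hswap : ∫⁻ p, ((Ioc a b)ᶜ ×ˢ Ioc a b).indicator
        (fun p => ENNReal.ofReal (|p.2 - p.1| ^ (-(1 + 2 * r)))) p ∂(volume.prod volume) =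
      ∫⁻ p, (Ioc a b ×ˢ (Ioc a b)ᶜ).indicator
        (fun p => ENNReal.ofReal (|p.2 - p.1| ^ (-(1 + 2 * r)))) p ∂(volume.prod volume) := by
    rw [← lintegral_prod_swap]
    refine lintegral_congr fun p => ?_
    by_cases h₁ : p.1 ∈ Ioc a b <;> by_cases h₂ : p.2 ∈ Ioc a b <;>
      simp [Set.indicator, Set.mem_prod, -Set.mem_Ioc, h₁, h₂, abs_sub_comm]
  have hm0 := (measurable_ofReal_abs_sub_rpow (-(2 * r))).indicator (hS.prod hS)
  have hm1 := (measurable_ofReal_abs_sub_rpow (-(1 + 2 * r))).indicator (hS.prod hS.compl)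
  have hm2 := (measurable_ofReal_abs_sub_rpow (-(1 + 2 * r))).indicator (hS.compl.prod hS)
  unfold intervalMajorant
  rw [lintegral_add_left (hm0.const_mul _), lintegral_add_left (hm1.const_mul _),
    lintegral_const_mul _ hm0, lintegral_const_mul _ hm1, lintegral_const_mul _ hm2, hswap,
    lintegral_indicator_prod hS hS (measurable_ofReal_abs_sub_rpow _),
    lintegral_indicator_prod hS hS.compl (measurable_ofReal_abs_sub_rpow _)]
  refine (add_le_add (mul_le_mul_right (lintegral_Ioc_Ioc_abs_sub_rpow_le hr hab) _)
    (add_le_add (mul_le_mul_right (lintegral_Ioc_compl_abs_sub_rpow_le hr0 hr hab) _)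
      (mul_le_mul_right (lintegral_Ioc_compl_abs_sub_rpow_le hr0 hr hab) _))).trans ?_
  rw [← ENNReal.ofReal_mul hG, ← ENNReal.ofReal_mul (by positivity),
    ← ENNReal.ofReal_add (by positivity) (by positivity),
    ← ENNReal.ofReal_add (by positivity) (by positivity)]
  refine ENNReal.ofReal_le_ofReal ?_
  have hpow : (b - a) ^ (2 - 2 * r) = (b - a) ^ (1 - 2 * r) * (b - a) := by
    rw [← Real.rpow_add_one hL.ne']
    ring_nf
  rw [hpow]
  set P := (b - a) ^ (1 - 2 * r)
  have hP : 0 ≤ G * (P * (b - a)) / (1 - 2 * r) := by positivity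
  have hr2 : 2 ≤ 1 / r := by
    rw [le_div_iff₀ hr0]
    linarith
  calc _ = G * (P * (b - a)) / (1 - 2 * r) * (2 + 4 * (1 / r)) := by
        field_simp
        ring
    _ ≤ G * (P * (b - a)) / (1 - 2 * r) * (5 * (1 / r)) := by
        gcongr
        linarith
    _ = _ := by field_simp

theorem sq_div_abs_rpow_le_of_sq_le {d z G r : ℝ} (hG : 0 ≤ G) (hd : d ^ 2 ≤ |z| * G) :
    |d| ^ 2 / |z| ^ (1 + 2 * r) ≤ G * |z| ^ (-(2 * r)) := by
  rcases eq_or_ne z 0 with rfl | hz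
  · have hd0 : d = 0 := by simpa using hd
    subst hd0
    simp only [abs_zero, ne_eq, OfNat.ofNat_ne_zero, not_false_eq_true, zero_pow, zero_div]
    positivity
  · have hz' : 0 < |z| := abs_pos.2 hz
    rw [sq_abs, div_le_iff₀ (by positivity), mul_assoc, ← Real.rpow_add hz']
    simpa [mul_comm] using hd

theorem exists_mem_Ioc_of_partition {t : ℕ → ℝ} {N : ℕ} {x : ℝ} (hx : x ∈ Ioc (t 0) (t N)) :
    ∃ i < N, x ∈ Ioc (t i) (t (i + 1)) := by
  induction N with
  | zero => exact absurd (hx.1.trans_le hx.2) (lt_irrefl _)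
  | succ n ih =>
    by_cases h : x ≤ t n
    · obtain ⟨i, hi, hxi⟩ := ih ⟨hx.1, h⟩
      exact ⟨i, hi.trans n.lt_succ_self, hxi⟩
    · exact ⟨n, n.lt_succ_self, not_le.1 h, hx.2⟩

theorem partition_le {t : ℕ → ℝ} {N : ℕ} (ht : ∀ i < N, t i < t (i + 1)) {i j : ℕ}
    (hij : i ≤ j) (hj : j ≤ N) : t i ≤ t j := by
  induction j, hij using Nat.le_induction with
  | base => exact le_rfl
  | succ n _ ih => exact (ih (by omega)).trans (ht n (by omega)).le

theorem notMem_Ioc_of_partition {t : ℕ → ℝ} {N : ℕ} (ht : ∀ i < N, t i < t (i + 1)) {i j : ℕ}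
    (hi : i < N) (hj : j < N) (hij : i ≠ j) {x : ℝ} (hx : x ∈ Ioc (t i) (t (i + 1))) :
    x ∉ Ioc (t j) (t (j + 1)) := by
  intro hx'
  rcases hij.lt_or_gt with h | h
  · exact (hx'.1.trans_le hx.2).not_ge (partition_le ht h hj.le)
  · exact (hx.1.trans_le hx'.2).not_ge (partition_le ht h hi.le)

theorem sum_indicator_partition {t : ℕ → ℝ} {N : ℕ} (ht : ∀ i < N, t i < t (i + 1)) (c : ℕ → ℝ)
    {i : ℕ} (hi : i < N) {x : ℝ} (hx : x ∈ Ioc (t i) (t (i + 1))) :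
    ∑ j ∈ Finset.range N, Set.indicator (Ioc (t j) (t (j + 1))) (fun _ => c j) x = c i := by
  rw [Finset.sum_eq_single_of_mem i (Finset.mem_range.2 hi) fun j hj hji =>
    Set.indicator_of_notMem
      (notMem_Ioc_of_partition ht hi (Finset.mem_range.1 hj) hji.symm hx) _,
    Set.indicator_of_mem hx]

theorem ofReal_setIntegral_setIntegral_le (F : ℝ → ℝ → ℝ) (S : Set ℝ) (hF : ∀ x y, 0 ≤ F x y) :
    ENNReal.ofReal (∫ x in S, ∫ y in S, F x y) ≤
      ∫⁻ x in S, ∫⁻ y in S, ENNReal.ofReal (F x y) := by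
  rw [← Real.enorm_of_nonneg (integral_nonneg fun x => integral_nonneg fun y => hF x y)]
  refine (enorm_integral_le_lintegral_enorm _).trans (lintegral_mono fun x => ?_)
  refine (enorm_integral_le_lintegral_enorm _).trans (lintegral_mono fun y => ?_)
  exact (Real.enorm_of_nonneg (hF x y)).le

/-- Gagliardo `H^r` seminorm part of Lemma 1: there is an absolute constant
`C > 0` such that for `0 < r < 1/2`, any partition of `(0,1)` into subintervals
of length at most `h`, any absolutely continuous `v` with square-integrable
derivative `g`, and `w = v - v_h` with `v_h` the piecewise constant interpolant,
`∬_{I×I} |w y - w x|² / |y - x|^(1+2r) ≤ (C/(r(1-2r))) h^(2-2r) ∫₀¹ g²`. -/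
theorem gagliardo_seminorm_bound :
    ∃ C > (0:ℝ), ∀ (r h : ℝ), 0 < r → r < 1 / 2 → 0 < h →
    ∀ (N : ℕ) (t : ℕ → ℝ), t 0 = 0 → t N = 1 →
    (∀ i < N, t i < t (i + 1)) →
    (∀ i < N, t (i + 1) - t i ≤ h) →
    ∀ (v g : ℝ → ℝ),
    IntegrableOn g (Icc (0:ℝ) 1) →
    IntegrableOn (fun s => g s ^ 2) (Icc (0:ℝ) 1) →
    (∀ p ∈ Icc (0:ℝ) 1, ∀ q ∈ Icc (0:ℝ) 1, v q - v p = ∫ s in p..q, g s) →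
    ∀ (xp : ℕ → ℝ), (∀ i < N, xp i ∈ Ioc (t i) (t (i + 1))) →
    ∀ (w : ℝ → ℝ),
    (∀ y, w y = v y -
      ∑ i ∈ Finset.range N, Set.indicator (Ioc (t i) (t (i + 1))) (fun _ => v (xp i)) y) →
    (∫ x in (0:ℝ)..1, ∫ y in (0:ℝ)..1, |w y - w x| ^ 2 / |y - x| ^ (1 + 2 * r)) ≤
      (C / (r * (1 - 2 * r))) * h ^ (2 - 2 * r) * ∫ s in (0:ℝ)..1, g s ^ 2 := by
  refine ⟨5, by norm_num, ?_⟩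
  intro r h hr0 hr hh N t ht0 htN ht hth v g hg hg2 hv xp hxp w hw
  have h1 : 0 < 1 - 2 * r := by linarith
  set G : ℕ → ℝ := fun i => ∫ s in (t i)..(t (i + 1)), g s ^ 2 with hGdef
  have hG : ∀ i < N, 0 ≤ G i := fun i hi =>
    intervalIntegral.integral_nonneg (ht i hi).le fun s _ => sq_nonneg _
  have hsub : ∀ i < N, Icc (t i) (t (i + 1)) ⊆ Icc (0 : ℝ) 1 := fun i hi =>
    Icc_subset_Icc (ht0 ▸ partition_le ht i.zero_le hi.le) (htN ▸ partition_le ht hi le_rfl)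
  have hi2 : ∀ i < N, IntervalIntegrable (fun s => g s ^ 2) volume (t i) (t (i + 1)) :=
    fun i hi => (intervalIntegrable_iff_integrableOn_Icc_of_le (ht i hi).le).2
      (hg2.mono_set (hsub i hi))
  have hsum : ∑ i ∈ Finset.range N, G i = ∫ s in (0:ℝ)..1, g s ^ 2 := by
    rw [← ht0, ← htN]
    exact intervalIntegral.sum_integral_adjacent_intervals hi2
  have hosc' : ∀ i < N, ∀ p ∈ Ioc (t i) (t (i + 1)), ∀ q ∈ Ioc (t i) (t (i + 1)), p ≤ q →
      (v q - v p) ^ 2 ≤ (q - p) * G i := by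
    intro i hi p hp q hq hpq
    have hpI := hsub i hi (Ioc_subset_Icc_self hp)
    have hqI := hsub i hi (Ioc_subset_Icc_self hq)
    have hss : Icc p q ⊆ Icc (0 : ℝ) 1 := Icc_subset_Icc hpI.1 hqI.2
    rw [hv p hpI q hqI]
    refine (sq_intervalIntegral_le hpq (hg.mono_set hss) (hg2.mono_set hss)).trans ?_
    refine mul_le_mul_of_nonneg_left ?_ (sub_nonneg.2 hpq)
    exact intervalIntegral.integral_mono_interval hp.1.le hpq hq.2
      (Filter.Eventually.of_forall fun s => sq_nonneg _) (hi2 i hi)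
  have hosc : ∀ i < N, ∀ p ∈ Ioc (t i) (t (i + 1)), ∀ q ∈ Ioc (t i) (t (i + 1)),
      (v q - v p) ^ 2 ≤ |q - p| * G i := by
    intro i hi p hp q hq
    rcases le_total p q with hpq | hpq
    · rw [abs_of_nonneg (sub_nonneg.2 hpq)]
      exact hosc' i hi p hp q hq hpq
    · rw [abs_sub_comm, abs_of_nonneg (sub_nonneg.2 hpq), sub_sq_comm]
      exact hosc' i hi q hq p hp hpq
  have hwi : ∀ i < N, ∀ x ∈ Ioc (t i) (t (i + 1)), w x = v x - v (xp i) := fun i hi x hx => by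
    rw [hw x, sum_indicator_partition ht (fun i => v (xp i)) hi hx]
  have hwsq : ∀ i < N, ∀ x ∈ Ioc (t i) (t (i + 1)), w x ^ 2 ≤ (t (i + 1) - t i) * G i := by
    intro i hi x hx
    rw [hwi i hi x hx]
    refine (hosc i hi _ (hxp i hi) x hx).trans (mul_le_mul_of_nonneg_right ?_ (hG i hi))
    rw [abs_le]
    constructor <;> linarith [hx.1, hx.2, (hxp i hi).1, (hxp i hi).2]
  set H : ℝ × ℝ → ENNReal := fun p =>
    ∑ i ∈ Finset.range N, intervalMajorant r (t i) (t (i + 1)) (G i) p with hH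
  have hHm : Measurable H :=
    Finset.measurable_fun_sum _ fun i _ => measurable_intervalMajorant _ _ _ _
  have hpt : ∀ x ∈ Ioc (0 : ℝ) 1, ∀ y ∈ Ioc (0 : ℝ) 1,
      ENNReal.ofReal (|w y - w x| ^ 2 / |y - x| ^ (1 + 2 * r)) ≤ H (x, y) := by
    intro x hx y hy
    rw [← ht0, ← htN] at hx hy
    obtain ⟨i, hi, hxi⟩ := exists_mem_Ioc_of_partition hx
    obtain ⟨j, hj, hyj⟩ := exists_mem_Ioc_of_partition hy
    rcases eq_or_ne i j with rfl | hij
    · refine le_trans ?_ (Finset.single_le_sum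
        (f := fun i => intervalMajorant r (t i) (t (i + 1)) (G i) (x, y))
        (fun _ _ => zero_le) (Finset.mem_range.2 hi))
      refine le_trans ?_ (le_add_right le_rfl)
      rw [Set.indicator_of_mem (Set.mk_mem_prod hxi hyj), ← ENNReal.ofReal_mul (hG i hi)]
      refine ENNReal.ofReal_le_ofReal (sq_div_abs_rpow_le_of_sq_le (hG i hi) ?_)
      rw [hwi i hi x hxi, hwi i hi y hyj, sub_sub_sub_cancel_right]
      exact hosc i hi x hxi y hyj
    · have hxj := notMem_Ioc_of_partition ht hi hj hij hxi
      have hyi := notMem_Ioc_of_partition ht hj hi hij.symm hyj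
      have hLi := mul_nonneg (sub_nonneg.2 (ht i hi).le) (hG i hi)
      have hLj := mul_nonneg (sub_nonneg.2 (ht j hj).le) (hG j hj)
      refine le_trans ?_ (Finset.sum_le_sum_of_subset
        (f := fun i => intervalMajorant r (t i) (t (i + 1)) (G i) (x, y))
        (s := {i, j}) (t := Finset.range N) ?_)
      · rw [Finset.sum_pair hij]
        refine le_trans ?_ (add_le_add (le_add_left (le_add_right le_rfl))
          (le_add_left (le_add_left le_rfl)))
        rw [Set.indicator_of_mem (Set.mk_mem_prod hxi hyi),
          Set.indicator_of_mem (Set.mk_mem_prod hxj hyj), ← ENNReal.ofReal_mul (by positivity),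
          ← ENNReal.ofReal_mul (by positivity),
          ← ENNReal.ofReal_add (by positivity) (by positivity), ← add_mul]
        refine ENNReal.ofReal_le_ofReal ?_
        rw [Real.rpow_neg (abs_nonneg _), ← div_eq_mul_inv, sq_abs]
        gcongr
        nlinarith [hwsq i hi x hxi, hwsq j hj y hyj, sq_nonneg (w y + w x)]
      · intro k hk
        rcases Finset.mem_insert.1 hk with rfl | hk
        · exact Finset.mem_range.2 hi
        · exact Finset.mem_range.2 (Finset.mem_singleton.1 hk ▸ hj)
  have hHint : ∫⁻ p, H p ∂(volume.prod volume) ≤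
      ENNReal.ofReal (5 / (r * (1 - 2 * r)) * h ^ (2 - 2 * r) * ∫ s in (0:ℝ)..1, g s ^ 2) := by
    rw [hH, lintegral_finsetSum _ fun i _ => measurable_intervalMajorant _ _ _ _, ← hsum,
      Finset.mul_sum, ENNReal.ofReal_sum_of_nonneg fun i hi =>
        mul_nonneg (by positivity) (hG i (Finset.mem_range.1 hi))]
    refine Finset.sum_le_sum fun i hi => ?_
    have hiN := Finset.mem_range.1 hi
    refine (lintegral_intervalMajorant_le hr0 hr (ht i hiN) (hG i hiN)).trans
      (ENNReal.ofReal_le_ofReal ?_)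
    have := hG i hiN
    have := hth i hiN
    have : 0 ≤ t (i + 1) - t i := sub_nonneg.2 (ht i hiN).le
    gcongr
    linarith
  have hG0 : 0 ≤ ∫ s in (0:ℝ)..1, g s ^ 2 :=
    intervalIntegral.integral_nonneg zero_le_one fun s _ => sq_nonneg _
  rw [← ENNReal.ofReal_le_ofReal_iff (by positivity)]
  simp_rw [intervalIntegral.integral_of_le (zero_le_one' ℝ)] at hHint ⊢
  calc _ ≤ ∫⁻ x in Ioc (0 : ℝ) 1, ∫⁻ y in Ioc (0 : ℝ) 1,
        ENNReal.ofReal (|w y - w x| ^ 2 / |y - x| ^ (1 + 2 * r)) :=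
        ofReal_setIntegral_setIntegral_le
          (fun x y => |w y - w x| ^ 2 / |y - x| ^ (1 + 2 * r)) _ fun x y => by positivity
    _ ≤ ∫⁻ x in Ioc (0 : ℝ) 1, ∫⁻ y in Ioc (0 : ℝ) 1, H (x, y) :=
        setLIntegral_mono' measurableSet_Ioc fun x hx =>
          setLIntegral_mono' measurableSet_Ioc fun y hy => hpt x hx y hy
    _ ≤ ∫⁻ x, ∫⁻ y, H (x, y) :=
        (setLIntegral_le_lintegral _ _).trans
          (lintegral_mono fun x => setLIntegral_le_lintegral _ _)
    _ = ∫⁻ p, H p ∂(volume.prod volume) := (lintegral_prod _ hHm.aemeasurable).symm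
    _ ≤ _ := hHint
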